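/- Let |ψ⟩ be a fully entangled stabilizer state on n ≥ 3 qubits. Then |ψ⟩ is local-Clifford equivalent to the n-qubit GHZ state |GHZₙ⟩ if and only if A_ω(ψ) = 1 for every ω ∈ {{1,2},{2,3},…,{n−1,n}}. -/

import Mathlib

open Matrix

noncomputable section

/-- Pauli matrices: `0 ↦ σ₀` (identity), `1 ↦ σₓ`, `2 ↦ σ_y`, `3 ↦ σ_z`. -/
def pauliMat : Fin 4 → Matrix (Fin 2) (Fin 2) ℂ :=
  ![1, !![0, 1; 1, 0], !![0, -Complex.I; Complex.I, 0], !![1, 0; 0, -1]]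

/-- Tensor (Kronecker) product of a family of one-qubit operators, as an operator
on qubits indexed by `ι`. -/
def kron {ι : Type} [Fintype ι] (U : ι → Matrix (Fin 2) (Fin 2) ℂ) :
    Matrix (ι → Fin 2) (ι → Fin 2) ℂ :=
  Matrix.of fun x y => ∏ i, U i (x i) (y i)

/-- An element of the Pauli group: a phase in `{1, -1, i, -i}` together with a
Pauli label (`σ₀, σₓ, σ_y, σ_z`) on every qubit. -/
structure PauliOp (ι : Type) where
  phase : ℂ
  label : ι → Fin 4
  phase_ok : phase = 1 ∨ phase = -1 ∨ phase = Complex.I ∨ phase = -Complex.I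

noncomputable instance {ι : Type} : DecidableEq (PauliOp ι) := Classical.decEq _

/-- The matrix of a Pauli group element. -/
def PauliOp.toMatrix {ι : Type} [Fintype ι] (M : PauliOp ι) :
    Matrix (ι → Fin 2) (ι → Fin 2) ℂ :=
  M.phase • kron fun i => pauliMat (M.label i)

/-- The support of a Pauli operator: the set of qubits on which it acts nontrivially. -/
def PauliOp.support {ι : Type} [Fintype ι] [DecidableEq ι] (M : PauliOp ι) : Finset ι :=
  Finset.univ.filter fun i => M.label i ≠ 0

/-- A (maximal) stabilizer on the qubits indexed by `ι`: an abelian subgroup of the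
Pauli group of cardinality `2^|ι|` which does not contain `-I`. -/
structure Stabilizer (ι : Type) [Fintype ι] [DecidableEq ι] where
  elems : Finset (PauliOp ι)
  one_mem : ∃ M ∈ elems, PauliOp.toMatrix M = 1
  mul_mem : ∀ M ∈ elems, ∀ N ∈ elems, ∃ K ∈ elems,
    PauliOp.toMatrix K = PauliOp.toMatrix M * PauliOp.toMatrix N
  comm : ∀ M ∈ elems, ∀ N ∈ elems,
    PauliOp.toMatrix M * PauliOp.toMatrix N = PauliOp.toMatrix N * PauliOp.toMatrix M
  neg_one_not_mem : ∀ M ∈ elems, PauliOp.toMatrix M ≠ -1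
  card_elems : elems.card = 2 ^ Fintype.card ι

variable {ι : Type} [Fintype ι] [DecidableEq ι]

/-- `ψ` is the stabilizer state of the stabilizer `S`: it is a unit vector fixed by
every element of `S`. -/
def stabilizesState (S : Stabilizer ι) (ψ : (ι → Fin 2) → ℂ) : Prop :=
  (∑ x, Complex.normSq (ψ x)) = 1 ∧ ∀ M ∈ S.elems, (PauliOp.toMatrix M).mulVec ψ = ψ

/-- `ψ` is a stabilizer state. -/
def IsStabilizerState (ψ : (ι → Fin 2) → ℂ) : Prop :=
  ∃ S : Stabilizer ι, stabilizesState S ψ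

/-- `A_ω(ψ)`: the number of stabilizer elements with support exactly `ω`. -/
def Aomega (S : Stabilizer ι) (ω : Finset ι) : ℕ :=
  (S.elems.filter fun M => PauliOp.support M = ω).card

/-- `ω` is a minimal support of `S`: it is the support of some element of `S`, and no
element of `S` has nonempty support strictly contained in `ω`. -/
def IsMinimalSupport (S : Stabilizer ι) (ω : Finset ι) : Prop :=
  (∃ M ∈ S.elems, PauliOp.support M = ω) ∧
    ∀ M ∈ S.elems, PauliOp.support M ⊂ ω → PauliOp.support M = ∅

/-- The matrices of the minimal elements of `S` (the elements whose support is a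
minimal support). -/
def minimalMatrices (S : Stabilizer ι) : Set (Matrix (ι → Fin 2) (ι → Fin 2) ℂ) :=
  {A | ∃ M ∈ S.elems, IsMinimalSupport S (PauliOp.support M) ∧ PauliOp.toMatrix M = A}

/-- `M` belongs to the subgroup `ℳ(ψ)` of `S` generated by the minimal elements.
(Every stabilizer element is an involution, so the generated submonoid coincides with
the generated subgroup.) -/
def inMinimalSubgroup (S : Stabilizer ι) (M : PauliOp ι) : Prop :=
  M ∈ S.elems ∧ PauliOp.toMatrix M ∈ Submonoid.closure (minimalMatrices S)

/-- A one-qubit Clifford operation: a unitary mapping each of the three Pauli matrices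
to a Pauli matrix, up to sign, under conjugation. -/
def IsClifford (U : Matrix (Fin 2) (Fin 2) ℂ) : Prop :=
  U ∈ Matrix.unitaryGroup (Fin 2) ℂ ∧
    ∃ π : Equiv.Perm (Fin 3), ∀ u : Fin 3, ∃ s : ℂ, (s = 1 ∨ s = -1) ∧
      U * pauliMat u.succ * Uᴴ = s • pauliMat (π u).succ

/-- Local unitary equivalence of pure states. -/
def LUequiv (ψ φ : (ι → Fin 2) → ℂ) : Prop :=
  ∃ U : ι → Matrix (Fin 2) (Fin 2) ℂ,
    (∀ i, U i ∈ Matrix.unitaryGroup (Fin 2) ℂ) ∧ (kron U).mulVec ψ = φ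

/-- Local Clifford equivalence of pure states. -/
def LCequiv (ψ φ : (ι → Fin 2) → ℂ) : Prop :=
  ∃ U : ι → Matrix (Fin 2) (Fin 2) ℂ,
    (∀ i, IsClifford (U i)) ∧ (kron U).mulVec ψ = φ

/-- Local Clifford equivalence of (possibly mixed) states. -/
def LCequivMixed (ρ ρ' : Matrix (ι → Fin 2) (ι → Fin 2) ℂ) : Prop :=
  ∃ U : ι → Matrix (Fin 2) (Fin 2) ℂ,
    (∀ i, IsClifford (U i)) ∧ kron U * ρ * (kron U)ᴴ = ρ'

/-- A pure state is fully entangled if it is not a tensor product of states on two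
complementary nonempty subsets of the qubits. -/
def FullyEntangled (ψ : (ι → Fin 2) → ℂ) : Prop :=
  ¬ ∃ (ω : Finset ι) (φ : ({i // i ∈ ω} → Fin 2) → ℂ) (χ : ({i // i ∉ ω} → Fin 2) → ℂ),
      ω ≠ ∅ ∧ ω ≠ Finset.univ ∧
        ∀ x : ι → Fin 2, ψ x = φ (fun i => x i.1) * χ (fun i => x i.1)

/-- Recombine an assignment on `ω` and one on its complement into a global assignment. -/
def mergeAssign (ω : Finset ι) (x : {i // i ∈ ω} → Fin 2) (z : {i // i ∉ ω} → Fin 2) :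
    ι → Fin 2 :=
  fun i => if h : i ∈ ω then x ⟨i, h⟩ else z ⟨i, h⟩

/-- The reduced density matrix `ρ_ω(ψ)` of the pure state `ψ` on the qubits in `ω`
(partial trace of `|ψ⟩⟨ψ|` over the qubits outside `ω`). -/
def reducedState (ψ : (ι → Fin 2) → ℂ) (ω : Finset ι) :
    Matrix ({i // i ∈ ω} → Fin 2) ({i // i ∈ ω} → Fin 2) ℂ :=
  Matrix.of fun x y =>
    ∑ z : {i // i ∉ ω} → Fin 2, ψ (mergeAssign ω x z) * (starRingEnd ℂ) (ψ (mergeAssign ω y z))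

/-- The restriction `α_M M_{i₁} ⊗ ⋯ ⊗ M_{i_k}` of a Pauli operator to the qubits in `ω`. -/
def PauliOp.restrict (M : PauliOp ι) (ω : Finset ι) :
    Matrix ({i // i ∈ ω} → Fin 2) ({i // i ∈ ω} → Fin 2) ℂ :=
  M.phase • kron fun i : {i // i ∈ ω} => pauliMat (M.label i.1)

/-- The `n`-qubit GHZ state `(|0…0⟩ + |1…1⟩)/√2`. -/
def ghz (n : ℕ) : (Fin n → Fin 2) → ℂ :=
  fun x => if x = (fun _ => 0) ∨ x = (fun _ => 1) then ((Real.sqrt 2 : ℝ)⁻¹ : ℂ) else 0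

/-- The `2n × 2n` binary symplectic form `P = [[0, I], [I, 0]]`. -/
def Pmat (n : ℕ) : Matrix (Fin n ⊕ Fin n) (Fin n ⊕ Fin n) (ZMod 2) :=
  Matrix.fromBlocks 0 1 1 0

end

section Kron

variable {ι : Type} [Fintype ι]

lemma kron_apply (U : ι → Matrix (Fin 2) (Fin 2) ℂ) (x y : ι → Fin 2) :
    kron U x y = ∏ i, U i (x i) (y i) := rfl

lemma kron_mul [DecidableEq ι] (U V : ι → Matrix (Fin 2) (Fin 2) ℂ) :
    kron U * kron V = kron fun i => U i * V i := by
  ext x y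
  simp only [Matrix.mul_apply, kron_apply, Finset.prod_univ_sum, Fintype.piFinset_univ,
    Finset.prod_mul_distrib]

lemma kron_diagonal [DecidableEq ι] (d : ι → Fin 2 → ℂ) :
    (kron fun i => Matrix.diagonal (d i)) = Matrix.diagonal fun x => ∏ i, d i (x i) := by
  ext x y
  rw [kron_apply]
  by_cases h : x = y
  · subst h
    simp
  · rw [Matrix.diagonal_apply_ne _ h]
    obtain ⟨i, hi⟩ := Function.ne_iff.mp h
    exact Finset.prod_eq_zero (Finset.mem_univ i) (Matrix.diagonal_apply_ne _ hi)

lemma kron_one [DecidableEq ι] :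
    kron (fun _ : ι => (1 : Matrix (Fin 2) (Fin 2) ℂ)) = 1 := by
  have := kron_diagonal (fun (_ : ι) (_ : Fin 2) => (1 : ℂ))
  simpa using this

lemma kron_smul (c : ι → ℂ) (U : ι → Matrix (Fin 2) (Fin 2) ℂ) :
    (kron fun i => c i • U i) = (∏ i, c i) • kron U := by
  ext x y
  simp [kron_apply, Finset.prod_mul_distrib]

lemma kron_conjTranspose (U : ι → Matrix (Fin 2) (Fin 2) ℂ) :
    (kron U)ᴴ = kron fun i => (U i)ᴴ := by
  ext x y
  simp [kron_apply, Matrix.conjTranspose_apply]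

lemma trace_kron [DecidableEq ι] (U : ι → Matrix (Fin 2) (Fin 2) ℂ) :
    (kron U).trace = ∏ i, (U i).trace := by
  simp only [Matrix.trace, Matrix.diag_apply, kron_apply, Finset.prod_univ_sum,
    Fintype.piFinset_univ]

lemma kron_conjTranspose_mul_self [DecidableEq ι] {U : ι → Matrix (Fin 2) (Fin 2) ℂ}
    (hU : ∀ i, U i ∈ Matrix.unitaryGroup (Fin 2) ℂ) : (kron U)ᴴ * kron U = 1 := by
  rw [kron_conjTranspose, kron_mul, ← kron_one]
  congr 1
  funext i
  exact Matrix.mem_unitaryGroup_iff'.mp (hU i)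

lemma not_fullyEntangled_of_prod [DecidableEq ι] [Nontrivial ι] (c : ℂ) (f : ι → Fin 2 → ℂ)
    {ψ : (ι → Fin 2) → ℂ} (h : ∀ x, ψ x = c * ∏ i, f i (x i)) : ¬ FullyEntangled ψ := by
  intro hent
  obtain ⟨a, b, hab⟩ := exists_pair_ne ι
  refine hent ⟨{a}, fun x => c * ∏ i, f i.1 (x i), fun x => ∏ i, f i.1 (x i),
    Finset.singleton_ne_empty a, ?_, fun x => ?_⟩
  · intro hu
    have := Finset.mem_univ b
    rw [← hu, Finset.mem_singleton] at this
    exact hab this.symm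
  · rw [h x, mul_assoc]
    refine congrArg (c * ·) ?_
    convert (Fintype.prod_subtype_mul_prod_subtype (fun i => i ∈ ({a} : Finset ι))
      fun i => f i (x i)).symm

end Kron

section PauliMatrices

lemma pauliMat_zero : pauliMat 0 = 1 := rfl

lemma pauliMat_three_eq_diagonal : pauliMat 3 = Matrix.diagonal ![1, -1] := by
  ext i j
  fin_cases i <;> fin_cases j <;> simp [pauliMat]

lemma pauliMat_mul_self (a : Fin 4) : pauliMat a * pauliMat a = 1 := by
  fin_cases a <;> ext i j <;> fin_cases i <;> fin_cases j <;>
    simp [pauliMat, Matrix.mul_apply, Fin.sum_univ_two]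

lemma pauliMat_conjTranspose (a : Fin 4) : (pauliMat a)ᴴ = pauliMat a := by
  fin_cases a <;> ext i j <;> fin_cases i <;> fin_cases j <;>
    simp [pauliMat, Matrix.conjTranspose_apply]

lemma trace_pauliMat_mul (a b : Fin 4) :
    (pauliMat a * pauliMat b).trace = if a = b then 2 else 0 := by
  fin_cases a <;> fin_cases b <;>
    simp [pauliMat, Matrix.trace, Fin.sum_univ_two] <;> norm_num

lemma pauliMat_mul_anticomm {a b : Fin 4} (ha : a ≠ 0) (hb : b ≠ 0) (hab : a ≠ b) :
    pauliMat a * pauliMat b = (-1 : ℂ) • (pauliMat b * pauliMat a) := by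
  fin_cases a <;> fin_cases b <;> simp_all <;> ext i j <;> fin_cases i <;> fin_cases j <;>
    simp [pauliMat, Matrix.mul_apply, Fin.sum_univ_two]

lemma pauliMat_apply_zero_zero {a : Fin 4} (h : pauliMat a 0 0 ≠ 0) :
    (a = 0 ∨ a = 3) ∧ pauliMat a 0 0 = 1 := by
  fin_cases a <;> simp_all [pauliMat]

lemma pauliMat_apply_zero_one {a : Fin 4} (h : pauliMat a 0 1 ≠ 0) :
    pauliMat a 0 0 = 0 ∧ pauliMat a 0 1 ^ 4 = 1 := by
  have hI : (-Complex.I) ^ 4 = 1 := by rw [neg_pow, Complex.I_pow_four]; norm_num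
  fin_cases a <;> simp_all [pauliMat]

end PauliMatrices

section Clifford

lemma IsClifford.exists_label {U : Matrix (Fin 2) (Fin 2) ℂ} (hU : IsClifford U) (a : Fin 4) :
    ∃ (s : ℂ) (b : Fin 4), (s = 1 ∨ s = -1) ∧ (b = 0 ↔ a = 0) ∧
      U * pauliMat a * Uᴴ = s • pauliMat b := by
  obtain ⟨hu, π, hπ⟩ := hU
  rcases Fin.eq_zero_or_eq_succ a with rfl | ⟨u, rfl⟩
  · refine ⟨1, 0, Or.inl rfl, Iff.rfl, ?_⟩
    rw [pauliMat_zero, mul_one, one_smul]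
    exact Matrix.mem_unitaryGroup_iff.mp hu
  · obtain ⟨s, hs, h⟩ := hπ u
    exact ⟨s, (π u).succ, hs, by simp [Fin.succ_ne_zero], h⟩

lemma IsClifford.conjTranspose {U : Matrix (Fin 2) (Fin 2) ℂ} (hU : IsClifford U) :
    IsClifford Uᴴ := by
  obtain ⟨hu, π, hπ⟩ := hU
  have h1 : Uᴴ * U = 1 := Matrix.mem_unitaryGroup_iff'.mp hu
  refine ⟨Unitary.star_mem hu, π.symm, fun u => ?_⟩
  obtain ⟨s, hs, h⟩ := hπ (π.symm u)
  have hss : s * s = 1 := by rcases hs with rfl | rfl <;> norm_num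
  refine ⟨s, hs, ?_⟩
  rw [Equiv.apply_symm_apply] at h
  have h2 : pauliMat u.succ = s • (U * pauliMat (π.symm u).succ * Uᴴ) := by
    rw [h, smul_smul, hss, one_smul]
  rw [h2, Matrix.conjTranspose_conjTranspose, Matrix.mul_smul, Matrix.smul_mul]
  congr 1
  calc Uᴴ * (U * pauliMat (π.symm u).succ * Uᴴ) * U
      = (Uᴴ * U) * pauliMat (π.symm u).succ * (Uᴴ * U) := by simp only [mul_assoc]
    _ = _ := by rw [h1, one_mul, mul_one]

lemma IsClifford.mul {U V : Matrix (Fin 2) (Fin 2) ℂ} (hU : IsClifford U) (hV : IsClifford V) :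
    IsClifford (U * V) := by
  obtain ⟨hu, π, hπ⟩ := hU
  obtain ⟨hv, ρ, hρ⟩ := hV
  refine ⟨mul_mem hu hv, π * ρ, fun u => ?_⟩
  obtain ⟨t, ht, h2⟩ := hρ u
  obtain ⟨s, hs, h1⟩ := hπ (ρ u)
  refine ⟨t * s, ?_, ?_⟩
  · rcases ht with rfl | rfl <;> rcases hs with rfl | rfl <;> simp
  · calc U * V * pauliMat u.succ * (U * V)ᴴ = U * (V * pauliMat u.succ * Vᴴ) * Uᴴ := by
          simp only [Matrix.conjTranspose_mul, mul_assoc]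
      _ = _ := by
          rw [h2, Matrix.mul_smul, Matrix.smul_mul, h1, smul_smul, Equiv.Perm.mul_apply]

lemma IsClifford.smul {U : Matrix (Fin 2) (Fin 2) ℂ} (hU : IsClifford U) {w : ℂ}
    (hw : star w * w = 1) : IsClifford (w • U) := by
  obtain ⟨hu, π, hπ⟩ := hU
  refine ⟨?_, π, fun u => ?_⟩
  · rw [Matrix.mem_unitaryGroup_iff', star_smul, Matrix.smul_mul, Matrix.mul_smul, smul_smul,
      hw, one_smul]
    exact Matrix.mem_unitaryGroup_iff'.mp hu
  · obtain ⟨s, hs, h⟩ := hπ u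
    refine ⟨s, hs, ?_⟩
    rw [Matrix.conjTranspose_smul, Matrix.mul_smul, Matrix.smul_mul, Matrix.smul_mul, smul_smul,
      hw, one_smul, h]

lemma isClifford_one : IsClifford 1 :=
  ⟨one_mem _, 1, fun _ => ⟨1, Or.inl rfl, by simp⟩⟩

lemma isClifford_pauliX : IsClifford (pauliMat 1) := by
  refine ⟨?_, 1, fun u => ?_⟩
  · rw [Matrix.mem_unitaryGroup_iff, Matrix.star_eq_conjTranspose, pauliMat_conjTranspose,
      pauliMat_mul_self]
  · fin_cases u
    · refine ⟨1, Or.inl rfl, ?_⟩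
      ext i j
      fin_cases i <;> fin_cases j <;>
        simp [pauliMat, Matrix.mul_apply, Fin.sum_univ_two, Matrix.conjTranspose_apply]
    all_goals
      refine ⟨-1, Or.inr rfl, ?_⟩
      ext i j
      fin_cases i <;> fin_cases j <;>
        simp [pauliMat, Matrix.mul_apply, Fin.sum_univ_two, Matrix.conjTranspose_apply]

/-- The one-qubit Clifford operation permuting the Pauli matrices cyclically,
`σₓ ↦ σ_y ↦ σ_z ↦ σₓ`. -/
noncomputable def cyclicClifford : Matrix (Fin 2) (Fin 2) ℂ :=
  !![((Real.sqrt 2 : ℝ)⁻¹ : ℂ), -Complex.I * ((Real.sqrt 2 : ℝ)⁻¹ : ℂ);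
    ((Real.sqrt 2 : ℝ)⁻¹ : ℂ), Complex.I * ((Real.sqrt 2 : ℝ)⁻¹ : ℂ)]

lemma inv_sqrt_two_mul_self :
    ((Real.sqrt 2 : ℝ)⁻¹ : ℂ) * ((Real.sqrt 2 : ℝ)⁻¹ : ℂ) = 1 / 2 := by
  rw [← mul_inv, ← Complex.ofReal_mul, Real.mul_self_sqrt (by norm_num)]
  norm_num

lemma cyclicClifford_conj (u : Fin 3) :
    cyclicClifford * pauliMat u.succ * cyclicCliffordᴴ = pauliMat (u + 1).succ := by
  have h := inv_sqrt_two_mul_self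
  have hI := Complex.I_mul_I
  set r := ((Real.sqrt 2 : ℝ)⁻¹ : ℂ) with hr
  have hs : (starRingEnd ℂ) r = r := by rw [hr, map_inv₀, Complex.conj_ofReal]
  fin_cases u <;> ext i j <;> fin_cases i <;> fin_cases j <;>
    simp [cyclicClifford, pauliMat, Matrix.mul_apply, Fin.sum_univ_two,
      Matrix.conjTranspose_apply, hs, ← hr, -Complex.ofReal_inv] <;> grind

lemma isClifford_cyclicClifford : IsClifford cyclicClifford := by
  refine ⟨?_, Equiv.addRight 1, fun u => ⟨1, Or.inl rfl, ?_⟩⟩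
  · rw [Matrix.mem_unitaryGroup_iff, Matrix.star_eq_conjTranspose]
    have h := inv_sqrt_two_mul_self
    have hI := Complex.I_mul_I
    set r := ((Real.sqrt 2 : ℝ)⁻¹ : ℂ) with hr
    have hs : (starRingEnd ℂ) r = r := by rw [hr, map_inv₀, Complex.conj_ofReal]
    ext i j
    fin_cases i <;> fin_cases j <;>
      simp [cyclicClifford, Matrix.mul_apply, Fin.sum_univ_two,
        Matrix.conjTranspose_apply, hs, ← hr, -Complex.ofReal_inv] <;> grind
  · rw [cyclicClifford_conj, one_smul]
    rfl

lemma exists_isClifford_conj_eq_pauliZ {a : Fin 4} (ha : a ≠ 0) :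
    ∃ V, IsClifford V ∧ V * pauliMat a * Vᴴ = pauliMat 3 := by
  have hc := isClifford_cyclicClifford
  have h0 := cyclicClifford_conj 0
  have h1 := cyclicClifford_conj 1
  fin_cases a
  · exact absurd rfl ha
  · refine ⟨cyclicClifford * cyclicClifford, hc.mul hc, ?_⟩
    calc cyclicClifford * cyclicClifford * pauliMat 1 * (cyclicClifford * cyclicClifford)ᴴ
        = cyclicClifford * (cyclicClifford * pauliMat 1 * cyclicCliffordᴴ) * cyclicCliffordᴴ := by
          simp only [Matrix.conjTranspose_mul, mul_assoc]
      _ = _ := by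
          exact (congrArg (fun A => cyclicClifford * A * cyclicCliffordᴴ) h0).trans h1
  · exact ⟨cyclicClifford, hc, h1⟩
  · exact ⟨1, isClifford_one, by simp⟩

lemma exists_isClifford_conj_eq_smul_pauliZ {a : Fin 4} (ha : a ≠ 0) {t : ℂ}
    (ht : t = 1 ∨ t = -1) : ∃ V, IsClifford V ∧ V * pauliMat a * Vᴴ = t • pauliMat 3 := by
  obtain ⟨V, hV, h⟩ := exists_isClifford_conj_eq_pauliZ ha
  rcases ht with rfl | rfl
  · exact ⟨V, hV, by rw [h, one_smul]⟩
  · refine ⟨pauliMat 1 * V, isClifford_pauliX.mul hV, ?_⟩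
    calc pauliMat 1 * V * pauliMat a * (pauliMat 1 * V)ᴴ
        = pauliMat 1 * (V * pauliMat a * Vᴴ) * (pauliMat 1)ᴴ := by
          simp only [Matrix.conjTranspose_mul, mul_assoc]
      _ = pauliMat 1 * pauliMat 3 * pauliMat 1 := by rw [h, pauliMat_conjTranspose]
      _ = (-1 : ℂ) • pauliMat 3 := by
          rw [pauliMat_mul_anticomm (by decide) (by decide) (by decide), Matrix.smul_mul,
            mul_assoc, pauliMat_mul_self, mul_one]

lemma isClifford_diagonal {c : ℂ} (hc : c ^ 4 = 1) : IsClifford (Matrix.diagonal ![1, c]) := by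
  have h : c = 1 ∨ c = -1 ∨ c = Complex.I ∨ c = -Complex.I := by
    have : (c - 1) * ((c + 1) * ((c - Complex.I) * (c + Complex.I))) = 0 := by
      linear_combination hc - (c ^ 2 - 1) * Complex.I_mul_I
    grind
  have hcc : c * (starRingEnd ℂ) c = 1 := by rcases h with rfl | rfl | rfl | rfl <;> simp
  refine ⟨?_, ?_⟩
  · rw [Matrix.mem_unitaryGroup_iff, Matrix.star_eq_conjTranspose]
    ext i j
    fin_cases i <;> fin_cases j <;> simp [hcc]
  · have key : ∀ (p : Equiv.Perm (Fin 3)) (s t : ℂ), (s = 1 ∨ s = -1) → (t = 1 ∨ t = -1) →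
        p 2 = 2 →
        (Matrix.diagonal ![1, c] * pauliMat 1 * (Matrix.diagonal ![1, c])ᴴ =
          s • pauliMat (p 0).succ) →
        (Matrix.diagonal ![1, c] * pauliMat 2 * (Matrix.diagonal ![1, c])ᴴ =
          t • pauliMat (p 1).succ) →
        ∃ π : Equiv.Perm (Fin 3), ∀ u : Fin 3, ∃ s : ℂ, (s = 1 ∨ s = -1) ∧
          Matrix.diagonal ![1, c] * pauliMat u.succ * (Matrix.diagonal ![1, c])ᴴ =
            s • pauliMat (π u).succ := by
      intro p s t hs ht h2 hx hy
      refine ⟨p, fun u => ?_⟩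
      fin_cases u
      · exact ⟨s, hs, hx⟩
      · exact ⟨t, ht, hy⟩
      · refine ⟨1, Or.inl rfl, ?_⟩
        simp only [Fin.reduceFinMk, h2]
        ext i j
        fin_cases i <;> fin_cases j <;> simp [pauliMat, hcc]
    rcases h with rfl | rfl | rfl | rfl
    · refine key 1 1 1 (by simp) (by simp) rfl ?_ ?_ <;> ext i j <;> fin_cases i <;>
        fin_cases j <;> simp [pauliMat]
    · refine key 1 (-1) (-1) (by simp) (by simp) rfl ?_ ?_ <;> ext i j <;> fin_cases i <;>
        fin_cases j <;> simp [pauliMat]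
    · refine key (Equiv.swap 0 1) 1 (-1) (by simp) (by simp) (by decide) ?_ ?_ <;> ext i j <;>
        fin_cases i <;> fin_cases j <;> simp [pauliMat]
    · refine key (Equiv.swap 0 1) (-1) 1 (by simp) (by simp) (by decide) ?_ ?_ <;> ext i j <;>
        fin_cases i <;> fin_cases j <;> simp [pauliMat]

end Clifford

section PauliOperators

variable {ι : Type} [Fintype ι] [DecidableEq ι]

lemma PauliOp.phase_ne_zero {κ : Type} (M : PauliOp κ) : M.phase ≠ 0 := by
  rcases M.phase_ok with h | h | h | h <;> simp [h]

lemma PauliOp.phase_pow_four {κ : Type} (M : PauliOp κ) : M.phase ^ 4 = 1 := by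
  rcases M.phase_ok with h | h | h | h <;> simp [h, neg_pow Complex.I 4] <;> norm_num

lemma PauliOp.toMatrix_apply {κ : Type} [Fintype κ] (M : PauliOp κ) (x y : κ → Fin 2) :
    M.toMatrix x y = M.phase * ∏ i, pauliMat (M.label i) (x i) (y i) := rfl

lemma PauliOp.toMatrix_mul_self (M : PauliOp ι) :
    M.toMatrix * M.toMatrix = (M.phase ^ 2) • (1 : Matrix (ι → Fin 2) (ι → Fin 2) ℂ) := by
  rw [PauliOp.toMatrix, Matrix.smul_mul, Matrix.mul_smul, smul_smul, kron_mul, pow_two]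
  simp only [pauliMat_mul_self, kron_one]

lemma PauliOp.trace_toMatrix_mul (M N : PauliOp ι) :
    (M.toMatrix * N.toMatrix).trace =
      if M.label = N.label then M.phase * N.phase * 2 ^ Fintype.card ι else 0 := by
  rw [PauliOp.toMatrix, PauliOp.toMatrix, Matrix.smul_mul, Matrix.mul_smul, smul_smul, kron_mul,
    Matrix.trace_smul, trace_kron, smul_eq_mul]
  simp only [trace_pauliMat_mul]
  split_ifs with h
  · simp [h]
  · obtain ⟨i, hi⟩ := Function.ne_iff.mp h
    rw [Finset.prod_eq_zero (Finset.mem_univ i) (if_neg hi), mul_zero]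

lemma PauliOp.toMatrix_injective :
    Function.Injective (PauliOp.toMatrix : PauliOp ι → Matrix (ι → Fin 2) (ι → Fin 2) ℂ) := by
  intro M N h
  have h1 := M.trace_toMatrix_mul N
  rw [← h, M.trace_toMatrix_mul M, if_pos rfl] at h1
  have hp := M.phase_ne_zero
  have h2 : (2 : ℂ) ^ Fintype.card ι ≠ 0 := pow_ne_zero _ two_ne_zero
  split_ifs at h1 with hl
  · have hphase : M.phase = N.phase := by
      have := mul_right_cancel₀ h2 h1
      exact mul_left_cancel₀ hp this
    cases M
    cases N
    simp_all
  · exact absurd h1 (mul_ne_zero (mul_ne_zero hp hp) h2)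

lemma PauliOp.mem_support {M : PauliOp ι} {i : ι} : i ∈ M.support ↔ M.label i ≠ 0 := by
  simp [PauliOp.support]

/-- Two Pauli operators that fix a common nonzero vector and overlap in a single qubit carry the
same Pauli matrix there. -/
lemma PauliOp.label_eq_of_mulVec_eq {M N : PauliOp ι} {ψ : (ι → Fin 2) → ℂ} (hψ : ψ ≠ 0)
    (hM : M.toMatrix *ᵥ ψ = ψ) (hN : N.toMatrix *ᵥ ψ = ψ) {j : ι} (hj : M.label j ≠ 0)
    (hj' : N.label j ≠ 0) (h : ∀ k, k ≠ j → M.label k = 0 ∨ N.label k = 0) :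
    M.label j = N.label j := by
  by_contra hne
  have hanti : M.toMatrix * N.toMatrix = (-1 : ℂ) • (N.toMatrix * M.toMatrix) := by
    have hk : (kron fun k => pauliMat (M.label k) * pauliMat (N.label k)) =
        (-1 : ℂ) • kron fun k => pauliMat (N.label k) * pauliMat (M.label k) := by
      have hc : (∏ k, if k = j then (-1 : ℂ) else 1) = -1 := by simp
      rw [← hc, ← kron_smul]
      congr 1
      funext k
      split_ifs with hk
      · subst hk
        exact pauliMat_mul_anticomm hj hj' hne
      · rcases h k hk with h0 | h0 <;> simp [h0, pauliMat_zero]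
    simp only [PauliOp.toMatrix, Matrix.smul_mul, Matrix.mul_smul, smul_smul, kron_mul, hk]
    congr 1
    ring
  have h1 : (M.toMatrix * N.toMatrix) *ᵥ ψ = ψ := by rw [← Matrix.mulVec_mulVec, hN, hM]
  rw [hanti, Matrix.smul_mulVec, ← Matrix.mulVec_mulVec, hM, hN] at h1
  apply hψ
  funext x
  have h2 := congrFun h1 x
  simp only [Pi.smul_apply, smul_eq_mul] at h2
  have h3 : 2 * ψ x = 0 := by linear_combination -h2
  simpa using h3

lemma exists_pauliOp_conj {U : ι → Matrix (Fin 2) (Fin 2) ℂ} (hU : ∀ i, IsClifford (U i))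
    (M : PauliOp ι) : ∃ M' : PauliOp ι,
      kron U * M.toMatrix * (kron U)ᴴ = M'.toMatrix ∧ M'.support = M.support := by
  choose s b hs hb hconj using fun i => (hU i).exists_label (M.label i)
  have hprod : (∏ i, s i) = 1 ∨ (∏ i, s i) = -1 := by
    refine Finset.prod_induction s (fun c => c = 1 ∨ c = -1) ?_ (Or.inl rfl) fun i _ => hs i
    rintro c d (rfl | rfl) (rfl | rfl) <;> simp
  refine ⟨⟨M.phase * ∏ i, s i, b, ?_⟩, ?_, ?_⟩
  · rcases M.phase_ok with h | h | h | h <;> rcases hprod with h' | h' <;> simp [h, h']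
  · rw [kron_conjTranspose, PauliOp.toMatrix, PauliOp.toMatrix, Matrix.mul_smul, Matrix.smul_mul,
      kron_mul, kron_mul]
    simp only [hconj]
    rw [kron_smul, smul_smul]
  · ext i
    simp only [PauliOp.mem_support]
    exact not_congr (hb i)

/-- The operator acting as `σ_z` on the qubits `i` and `j` and trivially elsewhere. -/
def pauliZZ (i j : ι) : PauliOp ι :=
  ⟨1, fun k => if k = i ∨ k = j then 3 else 0, Or.inl rfl⟩

lemma pauliZZ_support (i j : ι) : (pauliZZ i j).support = {i, j} := by
  ext k
  simp only [PauliOp.mem_support, pauliZZ, Finset.mem_insert, Finset.mem_singleton]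
  split_ifs with h <;> simp [h]

lemma pauliZZ_mulVec {i j : ι} (hij : i ≠ j) (φ : (ι → Fin 2) → ℂ) (x : ι → Fin 2) :
    ((pauliZZ i j).toMatrix *ᵥ φ) x =
      (![1, -1] : Fin 2 → ℂ) (x i) * (![1, -1] : Fin 2 → ℂ) (x j) * φ x := by
  have h : (pauliZZ i j).toMatrix = kron fun k => Matrix.diagonal fun a =>
      (if k = i then (![1, -1] : Fin 2 → ℂ) a else 1) *
        (if k = j then (![1, -1] : Fin 2 → ℂ) a else 1) := by
    rw [PauliOp.toMatrix]
    simp only [pauliZZ, one_smul]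
    congr 1
    funext k
    by_cases hi : k = i
    · have hj : k ≠ j := fun hj => hij (hi.symm.trans hj)
      simp only [hi, true_or, if_true, pauliMat_three_eq_diagonal, if_neg hij, mul_one]
    · by_cases hj : k = j
      · simp only [hj, or_true, if_true, pauliMat_three_eq_diagonal, if_neg hij.symm, one_mul]
      · simp [hi, hj, pauliMat_zero]
  rw [h, kron_diagonal, Matrix.mulVec_diagonal, Finset.prod_mul_distrib]
  simp

end PauliOperators

section Projector

variable {ι : Type} [Fintype ι] [DecidableEq ι]

lemma ne_zero_of_stabilizesState {S : Stabilizer ι} {ψ : (ι → Fin 2) → ℂ}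
    (hψ : stabilizesState S ψ) : ψ ≠ 0 := by
  rintro rfl
  simpa using hψ.1

lemma star_dotProduct_self {κ : Type} [Fintype κ] (ψ : κ → ℂ) :
    star ψ ⬝ᵥ ψ = ((∑ x, Complex.normSq (ψ x) : ℝ) : ℂ) := by
  simp [dotProduct, Complex.normSq_eq_conj_mul_self]

lemma Stabilizer.phase_eq {S : Stabilizer ι} {M : PauliOp ι} (hM : M ∈ S.elems) :
    M.phase = 1 ∨ M.phase = -1 := by
  obtain ⟨K, hK, h⟩ := S.mul_mem M hM M hM
  rw [M.toMatrix_mul_self] at h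
  have hne := S.neg_one_not_mem K hK
  rcases M.phase_ok with h' | h' | h' | h'
  · exact Or.inl h'
  · exact Or.inr h'
  all_goals
    refine absurd ?_ hne
    rw [h, h']
    simp

lemma Stabilizer.toMatrix_conjTranspose {S : Stabilizer ι} {M : PauliOp ι} (hM : M ∈ S.elems) :
    M.toMatrixᴴ = M.toMatrix := by
  rw [PauliOp.toMatrix, Matrix.conjTranspose_smul, kron_conjTranspose]
  simp only [pauliMat_conjTranspose]
  rcases S.phase_eq hM with h | h <;> simp [h]

lemma Stabilizer.trace_sum (S : Stabilizer ι) :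
    (∑ M ∈ S.elems, M.toMatrix).trace = 2 ^ Fintype.card ι := by
  obtain ⟨E, hE, hE1⟩ := S.one_mem
  have hid : E = ⟨1, fun _ => 0, Or.inl rfl⟩ := by
    apply PauliOp.toMatrix_injective
    rw [hE1, PauliOp.toMatrix]
    simp [pauliMat_zero, kron_one]
  rw [Matrix.trace_sum, Finset.sum_eq_single_of_mem E hE]
  · rw [hE1]
    simp
  · intro M hM hne
    have h := M.trace_toMatrix_mul E
    rw [hE1, mul_one] at h
    rw [h]
    refine if_neg fun hl => ?_
    rcases S.phase_eq hM with hp | hp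
    · apply hne
      cases M
      simp_all
    · refine S.neg_one_not_mem M hM ?_
      rw [PauliOp.toMatrix, hp, hl, hid]
      simp [pauliMat_zero, kron_one]

lemma Stabilizer.toMatrix_mul_sum {S : Stabilizer ι} {M : PauliOp ι} (hM : M ∈ S.elems) :
    M.toMatrix * ∑ N ∈ S.elems, N.toMatrix = ∑ N ∈ S.elems, N.toMatrix := by
  choose! f hf hfm using fun N hN => S.mul_mem M hM N hN
  have hinj : Set.InjOn f S.elems := by
    intro N hN N' hN' h
    have h1 : M.toMatrix * N.toMatrix = M.toMatrix * N'.toMatrix := by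
      rw [← hfm N hN, ← hfm N' hN', h]
    have h2 := congrArg (fun A => M.toMatrix * A) h1
    simp only [← mul_assoc, M.toMatrix_mul_self, Matrix.smul_mul, one_mul] at h2
    exact PauliOp.toMatrix_injective
      (smul_right_injective _ (pow_ne_zero 2 M.phase_ne_zero) h2)
  rw [Finset.mul_sum]
  refine Finset.sum_nbij f hf hinj ?_ fun N hN => (hfm N hN).symm
  exact Finset.surjOn_of_injOn_of_card_le f hf hinj le_rfl

open scoped ComplexOrder in
/-- The sum over a stabilizer is a multiple of the projector onto the stabilizer state. -/
lemma stabilizesState.sum_toMatrix {S : Stabilizer ι} {ψ : (ι → Fin 2) → ℂ}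
    (hψ : stabilizesState S ψ) :
    ∑ M ∈ S.elems, M.toMatrix = (2 ^ Fintype.card ι : ℂ) • Matrix.vecMulVec ψ (star ψ) := by
  set T := ∑ M ∈ S.elems, M.toMatrix with hT
  set c : ℂ := 2 ^ Fintype.card ι with hc
  have hcard : ((S.elems.card : ℕ) : ℂ) = c := by rw [S.card_elems]; push_cast; rfl
  set R := Matrix.vecMulVec ψ (star ψ) with hR
  have hTT : T * T = c • T := by
    conv_lhs => rw [hT, Finset.sum_mul]
    rw [Finset.sum_congr rfl fun M hM => S.toMatrix_mul_sum hM, Finset.sum_const, ← hcard,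
      Nat.cast_smul_eq_nsmul]
  have hTH : Tᴴ = T := by
    rw [hT, Matrix.conjTranspose_sum]
    exact Finset.sum_congr rfl fun M hM => S.toMatrix_conjTranspose hM
  have hRH : Rᴴ = R := by rw [hR, Matrix.conjTranspose_vecMulVec, star_star]
  have hTψ : T *ᵥ ψ = c • ψ := by
    rw [hT, Matrix.sum_mulVec, Finset.sum_congr rfl fun M hM => hψ.2 M hM, Finset.sum_const,
      ← hcard, Nat.cast_smul_eq_nsmul]
  have hTR : T * R = c • R := by
    rw [hR, Matrix.mul_vecMulVec, hTψ, Matrix.smul_vecMulVec]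
  have hcs : star c = c := by simp [hc]
  have hRT : R * T = c • R := by
    have := congrArg Matrix.conjTranspose hTR
    rwa [Matrix.conjTranspose_mul, Matrix.conjTranspose_smul, hTH, hRH, hcs] at this
  have hnorm : star ψ ⬝ᵥ ψ = 1 := by rw [star_dotProduct_self, hψ.1]; simp
  have hRR : R * R = R := by
    rw [hR, Matrix.vecMulVec_mul_vecMulVec, hnorm]
    simp
  have htr : R.trace = 1 := by
    rw [hR, Matrix.trace_vecMulVec, dotProduct_comm, hnorm]
  have hTtr : T.trace = c := S.trace_sum
  have hQ : (T - c • R) * (T - c • R)ᴴ = c • (T - c • R) := by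
    rw [Matrix.conjTranspose_sub, Matrix.conjTranspose_smul, hTH, hRH, hcs]
    simp only [sub_mul, mul_sub, Matrix.smul_mul, Matrix.mul_smul, hTT, hTR, hRT, hRR, smul_sub]
    abel
  have h0 : ((T - c • R) * (T - c • R)ᴴ).trace = 0 := by
    rw [hQ, Matrix.trace_smul, Matrix.trace_sub, Matrix.trace_smul, htr, hTtr]
    simp
  exact sub_eq_zero.mp (Matrix.trace_mul_conjTranspose_self_eq_zero_iff.mp h0)

/-- A stabilizer contains every Pauli operator that fixes its stabilizer state. -/
lemma stabilizesState.mem_elems {S : Stabilizer ι} {ψ : (ι → Fin 2) → ℂ}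
    (hψ : stabilizesState S ψ) {P : PauliOp ι} (hP : P.toMatrix *ᵥ ψ = ψ) : P ∈ S.elems := by
  have hnorm : star ψ ⬝ᵥ ψ = 1 := by rw [star_dotProduct_self, hψ.1]; simp
  have h1 : (P.toMatrix * ∑ M ∈ S.elems, M.toMatrix).trace = 2 ^ Fintype.card ι := by
    rw [hψ.sum_toMatrix, Matrix.mul_smul, Matrix.mul_vecMulVec, hP, Matrix.trace_smul,
      Matrix.trace_vecMulVec, dotProduct_comm, hnorm]
    simp
  rw [Finset.mul_sum, Matrix.trace_sum] at h1
  obtain ⟨M, hM, hne⟩ := Finset.exists_ne_zero_of_sum_ne_zero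
    (h1.trans_ne (pow_ne_zero (Fintype.card ι) (two_ne_zero (α := ℂ))))
  rw [P.trace_toMatrix_mul] at hne
  have hl : P.label = M.label := by
    by_contra h
    exact hne (if_neg h)
  have hMψ := hψ.2 M hM
  obtain ⟨x, hx⟩ := Function.ne_iff.mp (ne_zero_of_stabilizesState hψ)
  rw [Pi.zero_apply] at hx
  have e1 := congrFun hP x
  have e2 := congrFun hMψ x
  rw [PauliOp.toMatrix, Matrix.smul_mulVec, Pi.smul_apply, smul_eq_mul] at e1 e2
  rw [← hl] at e2
  have hv : (kron (fun i => pauliMat (P.label i)) *ᵥ ψ) x ≠ 0 := by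
    intro h0
    rw [h0, mul_zero] at e1
    exact hx e1.symm
  have hp : P.phase = M.phase := mul_right_cancel₀ hv (e1.trans e2.symm)
  have : P = M := by
    cases P
    cases M
    simp_all
  rwa [this]

end Projector

section GHZ

variable {n : ℕ}

lemma const_zero_ne_const_one [NeZero n] :
    (fun _ => 0 : Fin n → Fin 2) ≠ fun _ => 1 := fun h => by
  simpa using congrFun h 0

lemma mulVec_eq_of_support [NeZero n] (A : Matrix (Fin n → Fin 2) (Fin n → Fin 2) ℂ)
    {φ : (Fin n → Fin 2) → ℂ}
    (hφ : ∀ x, x ≠ (fun _ => 0) → x ≠ (fun _ => 1) → φ x = 0) (x : Fin n → Fin 2) :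
    (A *ᵥ φ) x = A x (fun _ => 0) * φ (fun _ => 0) + A x (fun _ => 1) * φ (fun _ => 1) := by
  rw [Matrix.mulVec, dotProduct]
  refine Fintype.sum_eq_add _ _ const_zero_ne_const_one fun y hy => ?_
  rw [hφ y hy.1 hy.2, mul_zero]

lemma ghz_zero : ghz n (fun _ => 0) = ((Real.sqrt 2 : ℝ)⁻¹ : ℂ) := by simp [ghz]

lemma ghz_one : ghz n (fun _ => 1) = ((Real.sqrt 2 : ℝ)⁻¹ : ℂ) := by simp [ghz]

lemma ghz_eq_zero (x : Fin n → Fin 2) (h0 : x ≠ fun _ => 0) (h1 : x ≠ fun _ => 1) :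
    ghz n x = 0 := by
  simp [ghz, h0, h1]

lemma inv_sqrt_two_ne_zero : ((Real.sqrt 2 : ℝ)⁻¹ : ℂ) ≠ 0 := by simp

lemma pauliZZ_mulVec_ghz {i j : Fin n} (hij : i ≠ j) :
    (pauliZZ i j).toMatrix *ᵥ ghz n = ghz n := by
  funext x
  rw [pauliZZ_mulVec hij]
  by_cases h0 : x = fun _ => 0
  · simp [h0]
  · by_cases h1 : x = fun _ => 1
    · simp [h1]
    · rw [ghz_eq_zero x h0 h1, mul_zero]

/-- A Pauli operator fixing the GHZ state and acting trivially on some qubit is a product of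
`σ_z` operators. -/
lemma label_of_mulVec_ghz [NeZero n] {P : PauliOp (Fin n)} (hP : P.toMatrix *ᵥ ghz n = ghz n)
    {k : Fin n} (hk : P.label k = 0) :
    P.phase = 1 ∧ ∀ i, P.label i = 0 ∨ P.label i = 3 := by
  have h := congrFun hP (fun _ => 0)
  rw [mulVec_eq_of_support _ ghz_eq_zero, ghz_zero, ghz_one, ← add_mul] at h
  have h1 := mul_right_cancel₀ inv_sqrt_two_ne_zero (h.trans (one_mul _).symm)
  have h2 : P.toMatrix (fun _ => 0) (fun _ => 1) = 0 := by
    rw [P.toMatrix_apply, Finset.prod_eq_zero (Finset.mem_univ k), mul_zero]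
    simp [hk, pauliMat_zero]
  rw [h2, add_zero, P.toMatrix_apply] at h1
  have hne : (∏ i, pauliMat (P.label i) 0 0) ≠ 0 := by
    intro h0
    rw [h0, mul_zero] at h1
    exact zero_ne_one h1
  have hi := fun i =>
    pauliMat_apply_zero_zero (Finset.prod_ne_zero_iff.mp hne i (Finset.mem_univ i))
  refine ⟨?_, fun i => (hi i).1⟩
  rwa [Finset.prod_congr rfl fun i _ => (hi i).2, Finset.prod_const_one, mul_one] at h1

lemma eq_of_mulVec_ghz [NeZero n] {P Q : PauliOp (Fin n)} (hP : P.toMatrix *ᵥ ghz n = ghz n)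
    (hQ : Q.toMatrix *ᵥ ghz n = ghz n) (hPQ : P.support = Q.support) {k : Fin n}
    (hk : k ∉ P.support) : P = Q := by
  have hPk : P.label k = 0 := by simpa [PauliOp.mem_support] using hk
  have hQk : Q.label k = 0 := by simpa [hPQ, PauliOp.mem_support] using hk
  obtain ⟨hp, hpl⟩ := label_of_mulVec_ghz hP hPk
  obtain ⟨hq, hql⟩ := label_of_mulVec_ghz hQ hQk
  have hl : P.label = Q.label := by
    funext i
    have hi : P.label i ≠ 0 ↔ Q.label i ≠ 0 := by
      rw [← PauliOp.mem_support, ← PauliOp.mem_support, hPQ]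
    rcases hpl i with h | h <;> rcases hql i with h' | h' <;> simp_all
  cases P
  cases Q
  simp_all

end GHZ

section LocalClifford

lemma conj_mulVec {ι : Type} [Fintype ι] [DecidableEq ι] {U : ι → Matrix (Fin 2) (Fin 2) ℂ}
    (hU : ∀ i, U i ∈ Matrix.unitaryGroup (Fin 2) ℂ) {A : Matrix (ι → Fin 2) (ι → Fin 2) ℂ}
    {ψ : (ι → Fin 2) → ℂ} (h : A *ᵥ ψ = ψ) :
    (kron U * A * (kron U)ᴴ) *ᵥ (kron U *ᵥ ψ) = kron U *ᵥ ψ := by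
  rw [Matrix.mulVec_mulVec, mul_assoc, kron_conjTranspose_mul_self hU, mul_one,
    ← Matrix.mulVec_mulVec, h]

variable {n : ℕ}

lemma aomega_eq_one_of_lcEquiv_ghz {S : Stabilizer (Fin n)} {ψ : (Fin n → Fin 2) → ℂ}
    (hψ : stabilizesState S ψ) (h : LCequiv ψ (ghz n)) {i j k : Fin n} (hij : i ≠ j)
    (hki : k ≠ i) (hkj : k ≠ j) : Aomega S {i, j} = 1 := by
  have : NeZero n := ⟨by rintro rfl; exact i.elim0⟩
  obtain ⟨U, hU, hUψ⟩ := h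
  have huu := fun i => (hU i).1
  rw [Aomega, Finset.card_eq_one]
  obtain ⟨N, hN, hNs⟩ := exists_pauliOp_conj (fun i => (hU i).conjTranspose) (pauliZZ i j)
  have hψ' : (kron fun i => (U i)ᴴ) *ᵥ ghz n = ψ := by
    rw [← hUψ, ← kron_conjTranspose, Matrix.mulVec_mulVec, kron_conjTranspose_mul_self huu,
      Matrix.one_mulVec]
  have hNψ : N.toMatrix *ᵥ ψ = ψ := by
    rw [← hN]
    conv_lhs => rw [← hψ']
    rw [conj_mulVec (fun i => (hU i).conjTranspose.1) (pauliZZ_mulVec_ghz hij), hψ']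
  have huniq : ∀ M M' : PauliOp (Fin n), M.toMatrix *ᵥ ψ = ψ → M'.toMatrix *ᵥ ψ = ψ →
      M.support = {i, j} → M'.support = {i, j} → M = M' := by
    intro M M' hM hM' hs hs'
    obtain ⟨P, hP, hPs⟩ := exists_pauliOp_conj hU M
    obtain ⟨P', hP', hPs'⟩ := exists_pauliOp_conj hU M'
    have e := conj_mulVec huu hM
    have e' := conj_mulVec huu hM'
    rw [hP, hUψ] at e
    rw [hP', hUψ] at e'
    have hPP : P = P' := eq_of_mulVec_ghz (k := k) e e' (by rw [hPs, hPs', hs, hs'])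
      (by rw [hPs, hs]; simp [hki, hkj])
    rw [← hPP, ← hP] at hP'
    apply PauliOp.toMatrix_injective
    have hc := congrArg (fun A => (kron U)ᴴ * A * kron U) hP'
    simpa only [mul_assoc, kron_conjTranspose_mul_self huu, mul_one, ← mul_assoc (kron U)ᴴ (kron U),
      one_mul] using hc.symm
  refine ⟨N, ?_⟩
  ext M
  rw [Finset.mem_filter, Finset.mem_singleton]
  constructor
  · rintro ⟨hM, hs⟩
    exact huniq M N (hψ.2 M hM) hNψ hs (hNs.trans (pauliZZ_support i j))
  · rintro rfl
    exact ⟨hψ.mem_elems hNψ, hNs.trans (pauliZZ_support i j)⟩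

/-- A vector with `σ_z σ_z` symmetry on all neighbouring qubits is supported on the two constant
bit strings. -/
lemma eq_zero_of_pauliZZ_mulVec {φ : (Fin n → Fin 2) → ℂ}
    (h : ∀ i : Fin n, ∀ hi : (i : ℕ) + 1 < n, (pauliZZ i ⟨i + 1, hi⟩).toMatrix *ᵥ φ = φ)
    (x : Fin n → Fin 2) (h0 : x ≠ fun _ => 0) (h1 : x ≠ fun _ => 1) : φ x = 0 := by
  by_contra hx
  have hstep : ∀ i : Fin n, ∀ hi : (i : ℕ) + 1 < n, x ⟨i + 1, hi⟩ = x i := by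
    intro i hi
    have e := congrFun (h i hi) x
    rw [pauliZZ_mulVec (by simp [Fin.ext_iff])] at e
    have e1 := mul_right_cancel₀ hx (e.trans (one_mul _).symm)
    revert e1
    generalize x ⟨i + 1, hi⟩ = b
    generalize x i = a
    fin_cases a <;> fin_cases b <;> simp <;> norm_num
  have hconst : ∀ (m : ℕ) (hm : m < n), x ⟨m, hm⟩ = x ⟨0, by lia⟩ := by
    intro m
    induction m with
    | zero => exact fun _ => rfl
    | succ m ih => exact fun hm => (hstep ⟨m, by lia⟩ hm).trans (ih _)
  rcases n with _ | n
  · exact h0 (Subsingleton.elim _ _)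
  · have h01 : x ⟨0, by lia⟩ = 0 ∨ x ⟨0, by lia⟩ = 1 := by
      generalize x ⟨0, _⟩ = a
      fin_cases a <;> simp
    rcases h01 with h' | h'
    · exact h0 (funext fun i => (hconst i i.2).trans h')
    · exact h1 (funext fun i => (hconst i i.2).trans h')

/-- If all neighbouring pairs of qubits are supports of stabilizer elements, then a local Clifford
operation maps the state to a vector with `σ_z σ_z` symmetry on all neighbouring qubits. -/
lemma exists_isClifford_pauliZZ {S : Stabilizer (Fin n)} {ψ : (Fin n → Fin 2) → ℂ} (hn : 2 ≤ n)
    (hψ : stabilizesState S ψ)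
    (h : ∀ i : Fin n, ∀ hi : (i : ℕ) + 1 < n, ∃ M ∈ S.elems, M.support = {i, ⟨i + 1, hi⟩}) :
    ∃ U : Fin n → Matrix (Fin 2) (Fin 2) ℂ, (∀ i, IsClifford (U i)) ∧
      ∀ i : Fin n, ∀ hi : (i : ℕ) + 1 < n,
        (pauliZZ i ⟨i + 1, hi⟩).toMatrix *ᵥ (kron U *ᵥ ψ) = kron U *ᵥ ψ := by
  choose M hM hMs using h
  have hmem : ∀ (i : Fin n) (hi : (i : ℕ) + 1 < n) (k : Fin n),
      (M i hi).label k ≠ 0 ↔ (k = i ∨ k = ⟨i + 1, hi⟩) := by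
    intro i hi k
    rw [← PauliOp.mem_support, hMs]
    simp
  obtain ⟨a, ha⟩ : ∃ a : Fin n → Fin 4, ∀ (i : Fin n) (hi : (i : ℕ) + 1 < n),
      (M i hi).label i = a i ∧ (M i hi).label ⟨i + 1, hi⟩ = a ⟨i + 1, hi⟩ := by
    refine ⟨fun j => if hj : (j : ℕ) + 1 < n then (M j hj).label j
      else (M ⟨j - 1, by lia⟩ (show (j : ℕ) - 1 + 1 < n by lia)).label j, fun i hi => ⟨?_, ?_⟩⟩
    · simp [hi]
    · by_cases hj : (i : ℕ) + 1 + 1 < n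
      · simp only [hj, dif_pos]
        refine PauliOp.label_eq_of_mulVec_eq (ne_zero_of_stabilizesState hψ) (hψ.2 _ (hM _ _))
          (hψ.2 _ (hM _ _)) ?_ ?_ fun k hk => ?_
        · rw [hmem]; exact Or.inr rfl
        · rw [hmem]; exact Or.inl rfl
        · by_contra! hc
          rw [hmem, hmem] at hc
          simp only [Fin.ext_iff] at hc
          exact hk (Fin.ext (show (k : ℕ) = i + 1 by lia))
      · simp [hj]
  have ha0 : ∀ j, a j ≠ 0 := by
    intro j
    by_cases hj : (j : ℕ) + 1 < n
    · rw [← (ha j hj).1, hmem]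
      exact Or.inl rfl
    · have e : (⟨(j : ℕ) - 1 + 1, by lia⟩ : Fin n) = j := Fin.ext (by simp only; lia)
      have := (ha ⟨j - 1, by lia⟩ (show (j : ℕ) - 1 + 1 < n by lia)).2
      simp only [e] at this
      rw [← this, hmem]
      exact Or.inr e.symm
  have hp : ∀ i hi, (M i hi).phase = 1 ∨ (M i hi).phase = -1 := fun i hi => S.phase_eq (hM i hi)
  obtain ⟨t, ht, htt⟩ : ∃ t : ℕ → ℂ, (∀ j, t j = 1 ∨ t j = -1) ∧
      ∀ (i : Fin n) (hi : (i : ℕ) + 1 < n), (M i hi).phase * (t i * t (i + 1)) = 1 := by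
    let q : ℕ → ℂ := fun k => if hk : k + 1 < n then (M ⟨k, by lia⟩ hk).phase else 1
    have hq : ∀ k, q k = 1 ∨ q k = -1 := by
      intro k
      by_cases hk : k + 1 < n
      · simpa only [q, hk, dif_pos] using hp ⟨k, by lia⟩ hk
      · simp [q, hk]
    have ht : ∀ j, (∏ k ∈ Finset.range j, q k) = 1 ∨ (∏ k ∈ Finset.range j, q k) = -1 := by
      intro j
      refine Finset.prod_induction q (fun c => c = 1 ∨ c = -1) ?_ (Or.inl rfl) fun i _ => hq i
      rintro c d (rfl | rfl) (rfl | rfl) <;> simp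
    refine ⟨fun j => ∏ k ∈ Finset.range j, q k, ht, fun i hi => ?_⟩
    have e : q i = (M i hi).phase := by simp [q, hi]
    simp only [Finset.prod_range_succ, e]
    rcases ht i with h1 | h1 <;> rcases hp i hi with h2 | h2 <;> simp [h1, h2]
  choose U hU hUa using fun j : Fin n => exists_isClifford_conj_eq_smul_pauliZ (ha0 j) (ht j)
  refine ⟨U, hU, fun i hi => ?_⟩
  have hconj : kron U * (M i hi).toMatrix * (kron U)ᴴ = (pauliZZ i ⟨i + 1, hi⟩).toMatrix := by
    have hij : (⟨i + 1, hi⟩ : Fin n) ≠ i := by simp [Fin.ext_iff]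
    have hk : ∀ k, U k * pauliMat ((M i hi).label k) * (U k)ᴴ =
        (if k = i ∨ k = ⟨i + 1, hi⟩ then t k else 1) •
          pauliMat (if k = i ∨ k = ⟨i + 1, hi⟩ then 3 else 0) := by
      intro k
      split_ifs with hk
      · rw [← hUa k]
        rcases hk with rfl | rfl
        · rw [(ha k hi).1]
        · rw [(ha i hi).2]
      · have h0 : (M i hi).label k = 0 := by
          by_contra hne
          exact hk ((hmem i hi k).mp hne)
        rw [h0, pauliMat_zero, mul_one, one_smul]
        exact Matrix.mem_unitaryGroup_iff.mp (hU k).1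
    have hprod : (∏ k : Fin n, if k = i ∨ k = ⟨i + 1, hi⟩ then t k else 1) = t i * t (i + 1) := by
      rw [← Finset.prod_filter]
      have : Finset.univ.filter (fun k : Fin n => k = i ∨ k = ⟨i + 1, hi⟩) = {i, ⟨i + 1, hi⟩} := by
        ext k
        simp
      rw [this, Finset.prod_pair hij.symm]
    rw [PauliOp.toMatrix, Matrix.mul_smul, Matrix.smul_mul, kron_conjTranspose, kron_mul, kron_mul]
    simp only [hk]
    rw [kron_smul, hprod, smul_smul, htt i hi, PauliOp.toMatrix]
    rfl
  rw [← hconj]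
  exact conj_mulVec (fun j => (hU j).1) (hψ.2 _ (hM i hi))

lemma ne_zero_of_fullyEntangled {ι : Type} [Fintype ι] [DecidableEq ι] [Nontrivial ι]
    {ψ : (ι → Fin 2) → ℂ} (hent : FullyEntangled ψ) {U : ι → Matrix (Fin 2) (Fin 2) ℂ}
    (hU : ∀ i, U i ∈ Matrix.unitaryGroup (Fin 2) ℂ) (y : ι → Fin 2) :
    ∃ x, x ≠ y ∧ (kron U *ᵥ ψ) x ≠ 0 := by
  by_contra! hc
  refine not_fullyEntangled_of_prod ((kron U *ᵥ ψ) y) (fun i b => (U i)ᴴ b (y i)) (fun x => ?_) hent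
  have h1 : (kron U)ᴴ *ᵥ (kron U *ᵥ ψ) = ψ := by
    rw [Matrix.mulVec_mulVec, kron_conjTranspose_mul_self hU, Matrix.one_mulVec]
  conv_lhs => rw [← h1]
  rw [Matrix.mulVec, dotProduct, Fintype.sum_eq_single y fun x hx => by rw [hc x hx, mul_zero],
    kron_conjTranspose, kron_apply, mul_comm]

lemma exists_apply_zero_eq_mul_apply_one [NeZero n] {S : Stabilizer (Fin n)}
    {ψ : (Fin n → Fin 2) → ℂ} (hψ : stabilizesState S ψ) {U : Fin n → Matrix (Fin 2) (Fin 2) ℂ}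
    (hU : ∀ i, IsClifford (U i))
    (hsupp : ∀ x, x ≠ (fun _ => 0) → x ≠ (fun _ => 1) → (kron U *ᵥ ψ) x = 0)
    (h0 : (kron U *ᵥ ψ) (fun _ => 0) ≠ 0) (h1 : (kron U *ᵥ ψ) (fun _ => 1) ≠ 0) :
    ∃ c : ℂ, c ^ 4 = 1 ∧ (kron U *ᵥ ψ) (fun _ => 0) = c * (kron U *ᵥ ψ) (fun _ => 1) := by
  have huu := fun i => (hU i).1
  have hsum : ∑ M ∈ S.elems, kron U * M.toMatrix * (kron U)ᴴ =
      (2 ^ Fintype.card (Fin n) : ℂ) • Matrix.vecMulVec (kron U *ᵥ ψ) (star (kron U *ᵥ ψ)) := by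
    rw [← Finset.sum_mul, ← Finset.mul_sum, hψ.sum_toMatrix, Matrix.mul_smul, Matrix.smul_mul,
      Matrix.mul_vecMulVec, Matrix.vecMulVec_mul, Matrix.star_mulVec]
  have hentry := congrFun (congrFun hsum fun _ => 0) fun _ => 1
  rw [Matrix.sum_apply] at hentry
  obtain ⟨M, hM, hne⟩ := Finset.exists_ne_zero_of_sum_ne_zero (hentry.trans_ne (by
    simp only [Matrix.smul_apply, Matrix.vecMulVec_apply, smul_eq_mul, Pi.star_apply]
    exact mul_ne_zero (pow_ne_zero _ two_ne_zero) (mul_ne_zero h0 (star_ne_zero.mpr h1))))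
  obtain ⟨P, hP, -⟩ := exists_pauliOp_conj hU M
  have hPφ := conj_mulVec huu (hψ.2 M hM)
  rw [hP] at hne hPφ
  have hlab : ∀ i, pauliMat (P.label i) 0 1 ≠ 0 := by
    rw [P.toMatrix_apply] at hne
    exact fun i => Finset.prod_ne_zero_iff.mp (right_ne_zero_of_mul hne) i (Finset.mem_univ i)
  have h00 : P.toMatrix (fun _ => 0) (fun _ => 0) = 0 := by
    rw [P.toMatrix_apply, Finset.prod_eq_zero (Finset.mem_univ 0), mul_zero]
    exact (pauliMat_apply_zero_one (hlab 0)).1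
  have e := congrFun hPφ fun _ => 0
  rw [mulVec_eq_of_support _ hsupp, h00, zero_mul, zero_add] at e
  refine ⟨_, ?_, e.symm⟩
  rw [P.toMatrix_apply, mul_pow, P.phase_pow_four, one_mul, ← Finset.prod_pow]
  exact Finset.prod_eq_one fun i _ => (pauliMat_apply_zero_one (hlab i)).2

lemma lcEquiv_ghz_of_support [NeZero n] {ψ : (Fin n → Fin 2) → ℂ}
    (hnorm : ∑ x, Complex.normSq (ψ x) = 1) {U : Fin n → Matrix (Fin 2) (Fin 2) ℂ}
    (hU : ∀ i, IsClifford (U i))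
    (hsupp : ∀ x, x ≠ (fun _ => 0) → x ≠ (fun _ => 1) → (kron U *ᵥ ψ) x = 0) {c : ℂ}
    (hc : c ^ 4 = 1) (h : (kron U *ᵥ ψ) (fun _ => 0) = c * (kron U *ᵥ ψ) (fun _ => 1)) :
    LCequiv ψ (ghz n) := by
  set φ := kron U *ᵥ ψ with hφ
  set α := φ (fun _ => 0) with hα
  set β := φ (fun _ => 1) with hβ
  have hcc : star c * c = 1 := by
    have h1 : ‖c‖ = 1 := by
      have := congrArg norm hc
      rw [norm_pow, norm_one] at this
      exact (pow_eq_one_iff_of_nonneg (norm_nonneg c) (by norm_num)).mp this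
    rw [Complex.star_def, ← Complex.normSq_eq_conj_mul_self, Complex.normSq_eq_norm_sq, h1]
    simp
  have hφn : star φ ⬝ᵥ φ = 1 := by
    rw [hφ, Matrix.star_mulVec, Matrix.dotProduct_mulVec, Matrix.vecMul_vecMul,
      kron_conjTranspose_mul_self fun i => (hU i).1, Matrix.vecMul_one, star_dotProduct_self, hnorm]
    simp
  have hαβ : star α * α + star β * β = 1 := by
    rw [← hφn, dotProduct, Fintype.sum_eq_add _ _ const_zero_ne_const_one]
    · rfl
    · intro x hx
      rw [hsupp x hx.1 hx.2, mul_zero]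
  set r := ((Real.sqrt 2 : ℝ)⁻¹ : ℂ) with hr
  have hrr : r * r = 1 / 2 := inv_sqrt_two_mul_self
  have hrs : star r = r := by rw [Complex.star_def, hr, map_inv₀, Complex.conj_ofReal]
  have hαα : star α * α = 1 / 2 := by
    have : star α * α = star β * β := by
      rw [h, star_mul']
      linear_combination (star β * β) * hcc
    linear_combination (hαβ + this) / 2
  have hα0 : α ≠ 0 := by
    rintro h0
    rw [h0] at hαα
    norm_num at hαα
  let D : Fin n → Matrix (Fin 2) (Fin 2) ℂ := fun i =>
    if i = 0 then (r / α) • Matrix.diagonal ![1, c] else 1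
  have hD : ∀ i, IsClifford (D i) := by
    intro i
    by_cases hi : i = 0
    · simp only [D, hi, if_true]
      refine (isClifford_diagonal hc).smul ?_
      rw [star_div₀, hrs, div_mul_div_comm, hrr, hαα]
      norm_num
    · simp only [D, hi, if_false]
      exact isClifford_one
  refine ⟨fun i => D i * U i, fun i => (hD i).mul (hU i), ?_⟩
  rw [← kron_mul, ← Matrix.mulVec_mulVec, ← hφ]
  have hDk : kron D = Matrix.diagonal fun x => (r / α) * (![1, c] : Fin 2 → ℂ) (x 0) := by
    have : D = fun i => Matrix.diagonal fun b =>
        if i = 0 then (r / α) * (![1, c] : Fin 2 → ℂ) b else 1 := by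
      funext i
      by_cases hi : i = 0
      · simp only [D, hi, if_true, ← Matrix.diagonal_smul]
        rfl
      · simp [D, hi]
    rw [this, kron_diagonal]
    simp
  funext x
  rw [hDk, Matrix.mulVec_diagonal]
  by_cases h0 : x = fun _ => 0
  · subst h0
    rw [ghz_zero, ← hα, ← hr]
    simp only [Matrix.cons_val_zero]
    field_simp
  · by_cases h1 : x = fun _ => 1
    · subst h1
      rw [ghz_one, ← hβ, ← hr]
      simp only [Matrix.cons_val_one, Matrix.cons_val_fin_one]
      rw [mul_assoc, ← h, div_mul_cancel₀ _ hα0]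
    · rw [hsupp x h0 h1, ghz_eq_zero x h0 h1, mul_zero]

end LocalClifford

/-- A fully entangled stabilizer state on `n ≥ 3` qubits is local
Clifford equivalent to the GHZ state iff `A_ω(ψ) = 1` for every
`ω ∈ {{1,2}, {2,3}, …, {n-1,n}}`. -/
theorem stmt_9 {n : ℕ} (hn : 3 ≤ n) (S : Stabilizer (Fin n)) (ψ : (Fin n → Fin 2) → ℂ)
    (hψ : stabilizesState S ψ) (hent : FullyEntangled ψ) :
    LCequiv ψ (ghz n) ↔
      ∀ i : Fin n, ∀ h : (i : ℕ) + 1 < n,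
        Aomega S {i, ⟨(i : ℕ) + 1, h⟩} = 1 := by
  have : NeZero n := ⟨by lia⟩
  have : Nontrivial (Fin n) := Fin.nontrivial_iff_two_le.mpr (by lia)
  constructor
  · intro h i hi
    obtain ⟨k, hki, hkj⟩ : ∃ k : Fin n, k ≠ i ∧ k ≠ ⟨i + 1, hi⟩ := by
      by_cases h2 : (i : ℕ) + 2 < n
      · exact ⟨⟨i + 2, h2⟩, by simp [Fin.ext_iff], by simp [Fin.ext_iff]⟩
      · refine ⟨⟨0, by lia⟩, fun h0 => ?_, fun h0 => ?_⟩
        · have : 0 = (i : ℕ) := congrArg Fin.val h0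
          lia
        · have : 0 = (i : ℕ) + 1 := congrArg Fin.val h0
          lia
    exact aomega_eq_one_of_lcEquiv_ghz hψ h (by simp [Fin.ext_iff]) hki hkj
  · intro h
    obtain ⟨U, hU, hZ⟩ := exists_isClifford_pauliZZ (by lia) hψ fun i hi => by
      obtain ⟨M, hM⟩ := Finset.card_eq_one.mp (h i hi)
      have hmem := Finset.mem_singleton_self M
      rw [← hM, Finset.mem_filter] at hmem
      exact ⟨M, hmem⟩
    have hsupp := eq_zero_of_pauliZZ_mulVec hZ
    have h0 : (kron U *ᵥ ψ) (fun _ => 0) ≠ 0 := by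
      obtain ⟨x, hx, hne⟩ := ne_zero_of_fullyEntangled hent (fun i => (hU i).1) fun _ => 1
      by_contra hc
      exact hne (hsupp x (fun hx0 => hne (hx0 ▸ hc)) hx)
    have h1 : (kron U *ᵥ ψ) (fun _ => 1) ≠ 0 := by
      obtain ⟨x, hx, hne⟩ := ne_zero_of_fullyEntangled hent (fun i => (hU i).1) fun _ => 0
      by_contra hc
      exact hne (hsupp x hx fun hx1 => hne (hx1 ▸ hc))
    obtain ⟨c, hc, hcα⟩ := exists_apply_zero_eq_mul_apply_one hψ hU hsupp h0 h1
    exact lcEquiv_ghz_of_support hψ.1 hU hsupp hc hcα
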